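/- Riccati equation for X₁₂: in the Lagrange-symmetric GBDT setup with r₁ ≡ r₂ ≡ 0, the (1,2) entry of X(x) = JΠ(x)*S(x)⁻¹Π(x) satisfies, at every point where S(x) is invertible, X₁₂′ = p⁻¹(X₂₂ − X₁₁) − ωX₁₂². -/

import Mathlib

open Matrix Set

attribute [local instance] Matrix.normedAddCommGroup Matrix.normedSpace

theorem Matrix.hasDerivAt_iff_apply {m n : Type*} [Fintype m] [Fintype n]
    {M : ℝ → Matrix m n ℂ} {M' : Matrix m n ℂ} {x : ℝ} :
    HasDerivAt M M' x ↔ ∀ i j, HasDerivAt (fun t => M t i j) (M' i j) x :=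
  hasDerivAt_pi.trans (forall_congr' fun _ => hasDerivAt_pi)

theorem HasDerivAt.matrix_mul {l m n : Type*} [Fintype l] [Fintype m] [Fintype n]
    {M : ℝ → Matrix l m ℂ} {M' : Matrix l m ℂ} {N : ℝ → Matrix m n ℂ} {N' : Matrix m n ℂ} {x : ℝ}
    (hM : HasDerivAt M M' x) (hN : HasDerivAt N N' x) :
    HasDerivAt (fun t => M t * N t) (M' * N x + M x * N') x := by
  rw [Matrix.hasDerivAt_iff_apply] at *
  intro i j
  simp only [Matrix.mul_apply, Matrix.add_apply, ← Finset.sum_add_distrib]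
  exact HasDerivAt.fun_sum fun k _ => (hM i k).mul (hN k j)

theorem HasDerivAt.matrix_conjTranspose {m n : Type*} [Fintype m] [Fintype n]
    {M : ℝ → Matrix m n ℂ} {M' : Matrix m n ℂ} {x : ℝ} (hM : HasDerivAt M M' x) :
    HasDerivAt (fun t => (M t)ᴴ) M'ᴴ x := by
  rw [Matrix.hasDerivAt_iff_apply] at *
  exact fun i j => (hM j i).star

theorem HasDerivAt.matrix_inv {n : Type*} [Fintype n] [DecidableEq n]
    {M : ℝ → Matrix n n ℂ} {M' : Matrix n n ℂ} {x : ℝ} (hM : HasDerivAt M M' x)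
    (hx : IsUnit (M x)) :
    HasDerivAt (fun t => (M t)⁻¹) (-((M x)⁻¹ * M' * (M x)⁻¹)) x := by
  let _ := Matrix.linftyOpNormedRing (n := n) (α := ℂ)
  let _ := Matrix.linftyOpNormedAlgebra (n := n) (R := ℝ) (α := ℂ)
  have : HasSummableGeomSeries (Matrix n n ℂ) :=
    @instHasSummableGeomSeriesOfCompleteSpace _ _ (FiniteDimensional.complete ℝ _)
  obtain ⟨u, hu⟩ := hx
  have h := hasFDerivAt_ringInverse (𝕜 := ℝ) u
  rw [hu] at h
  have h' := h.comp_hasDerivAt x hM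
  have huinv : (↑u⁻¹ : Matrix n n ℂ) = (M x)⁻¹ := by rw [← hu, Matrix.coe_units_inv]
  simp only [Matrix.nonsing_inv_eq_ringInverse]
  rw [huinv] at h'
  simpa [Function.comp_def, Matrix.nonsing_inv_eq_ringInverse] using! h'

/-- **Riccati equation for `X₁₂`.**  In the Lagrange-symmetric GBDT setup with
`r₁ ≡ r₂ ≡ 0` (so `J = [[0,1],[−1,0]]`, `H₁ = [[ω,0],[0,0]]`, `H₀ = [[−q,0],[0,p⁻¹]]`),
the `(1,2)` entry of `X = JΠ*S⁻¹Π` satisfies, at every point where `S(x)` is invertible,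
`X₁₂' = p⁻¹(X₂₂ − X₁₁) − ωX₁₂²`. -/
theorem gbdt_X12_riccati
    (n : ℕ) (ℓ : ℝ)
    (ω p q : ℝ → ℝ)
    (J : Matrix (Fin 2) (Fin 2) ℂ) (hJ : J = !![0, 1; -1, 0])
    (H₁ H₀ : ℝ → Matrix (Fin 2) (Fin 2) ℂ)
    (hH₁ : H₁ = fun x => !![(ω x : ℂ), 0; 0, 0])
    (hH₀ : H₀ = fun x => !![-(q x : ℂ), 0; 0, ((p x : ℂ))⁻¹])
    (A : Matrix (Fin n) (Fin n) ℂ)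
    (Pi : ℝ → Matrix (Fin n) (Fin 2) ℂ)
    (S : ℝ → Matrix (Fin n) (Fin n) ℂ)
    (hS0 : (S 0).IsHermitian)
    (hInit : A * S 0 - S 0 * Aᴴ = Pi 0 * J * (Pi 0)ᴴ)
    (hPi : ∀ x ∈ Ico (0 : ℝ) ℓ,
      HasDerivAt Pi (-(A * Pi x * J * H₁ x) - Pi x * J * H₀ x) x)
    (hS : ∀ x ∈ Ico (0 : ℝ) ℓ,
      HasDerivAt S (Pi x * J * H₁ x * Jᴴ * (Pi x)ᴴ) x)
    (X : ℝ → Matrix (Fin 2) (Fin 2) ℂ)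
    (hX : X = fun x => J * (Pi x)ᴴ * (S x)⁻¹ * Pi x) :
    ∀ x ∈ Ico (0 : ℝ) ℓ, IsUnit (S x) →
      HasDerivAt (fun t => X t 0 1)
        (((p x : ℂ))⁻¹ * (X x 1 1 - X x 0 0) - (ω x : ℂ) * (X x 0 1) ^ 2) x := by
  intro x hx hu
  have hPix := hPi x hx
  have hSinv := (hS x hx).matrix_inv hu
  have hD := ((((hasDerivAt_const x J).matrix_mul hPix.matrix_conjTranspose).matrix_mul
    hSinv).matrix_mul hPix)
  have hD01 := Matrix.hasDerivAt_iff_apply.mp hD 0 1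
  set P' := -(A * Pi x * J * H₁ x) - Pi x * J * H₀ x with hP'
  have hcol (i : Fin n) : P' i 1 = -((p x : ℂ)⁻¹ * Pi x i 0) := by
    simp [hP', hJ, hH₁, hH₀, Matrix.mul_apply, Fin.sum_univ_two, mul_comm]
  have hleft (M : Matrix (Fin n) (Fin 2) ℂ) :
      (J * P'ᴴ * M) 0 1 = (p x : ℂ)⁻¹ * (J * (Pi x)ᴴ * M) 1 1 := by
    have hrow (k : Fin n) : (J * P'ᴴ) 0 k = (p x : ℂ)⁻¹ * (J * (Pi x)ᴴ) 1 k := by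
      rw [Matrix.mul_apply, Matrix.mul_apply]
      simp [hJ, hcol, Fin.sum_univ_two]
    simp only [Matrix.mul_apply (M := J * P'ᴴ), Matrix.mul_apply (M := J * (Pi x)ᴴ), hrow,
      Finset.mul_sum, mul_assoc]
  have hright (M : Matrix (Fin 2) (Fin n) ℂ) :
      (M * P') 0 1 = -((p x : ℂ)⁻¹ * (M * Pi x) 0 0) := by
    simp only [Matrix.mul_apply, hcol, Finset.mul_sum, ← Finset.sum_neg_distrib]
    exact Finset.sum_congr rfl fun _ _ => by ring
  have hN : J * H₁ x * Jᴴ = !![0, 0; (ω x : ℂ), 0] * J := by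
    ext i j
    fin_cases i <;> fin_cases j <;>
      simp [hJ, hH₁, Matrix.vecMul, dotProduct, Fin.sum_univ_two]
  have hmid : J * (Pi x)ᴴ * ((S x)⁻¹ * (Pi x * J * H₁ x * Jᴴ * (Pi x)ᴴ) * (S x)⁻¹) * Pi x =
      X x * !![0, 0; (ω x : ℂ), 0] * X x := by
    rw [Matrix.mul_assoc (Pi x), Matrix.mul_assoc (Pi x), hN, hX]
    simp only [Matrix.mul_assoc]
  have hXx : J * (Pi x)ᴴ * (S x)⁻¹ * Pi x = X x := by rw [hX]
  rw [hX]
  refine hD01.congr_deriv ?_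
  simp only [Matrix.zero_mul, zero_add, Matrix.add_mul, Matrix.mul_neg, Matrix.neg_mul,
    Matrix.add_apply, Matrix.neg_apply, hmid, hright, hXx]
  rw [Matrix.mul_assoc _ (S x)⁻¹ (Pi x), hleft, ← Matrix.mul_assoc, hXx]
  simp only [Matrix.mul_apply, Fin.sum_univ_two]
  simp
  ring
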